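/- Let A = diag(λ₁, λ₂) be a 2×2 complex diagonal matrix with |λ₁| = |λ₂| = λ > 1 and λ₂ = λ₁·e^{iφ} with φ ∈ (0, 2π), and suppose φ/(2π) is irrational. Let C ∈ ℂ^{m×2} with rank(C) = 1 and (C,A) detectable (degenerate system). Let Q, R, Σ₀ be Hermitian positive definite, (γ_k) i.i.d. Bernoulli with P(γ_k = 1) = p, and let P_k be the associated Riccati recursion. Then the critical value is p_c = 1 − λ^{−2}: if p > 1 − λ^{−2} then sup_k E[P_k] is bounded for every initial condition, and if p < 1 − λ^{−2} then sup_k E[P_k] is unbounded for some initial condition. -/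

import Mathlib

open Matrix MeasureTheory ProbabilityTheory
open scoped ComplexOrder ENNReal

/-- One step of the lossy Riccati recursion:
`X ↦ A X Aᴴ + Q − γ · A X Cᴴ (C X Cᴴ + R)⁻¹ C X Aᴴ`. -/
noncomputable def riccStep {ι κ : Type} [Fintype ι] [Fintype κ] [DecidableEq ι] [DecidableEq κ]
    (A : Matrix ι ι ℂ) (C : Matrix κ ι ℂ)
    (Q : Matrix ι ι ℂ) (R : Matrix κ κ ℂ) (g : ℝ)
    (X : Matrix ι ι ℂ) : Matrix ι ι ℂ :=
  A * X * Aᴴ + Q - (g : ℂ) • (A * X * Cᴴ * (C * X * Cᴴ + R)⁻¹ * (C * X * Aᴴ))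

/-- The lossy Riccati recursion `P₀ = S0`, `P_{k+1} = riccStep (γ k) (P k)`. -/
noncomputable def ricc {ι κ : Type} [Fintype ι] [Fintype κ] [DecidableEq ι] [DecidableEq κ]
    (A : Matrix ι ι ℂ) (C : Matrix κ ι ℂ)
    (Q : Matrix ι ι ℂ) (R : Matrix κ κ ℂ) (S0 : Matrix ι ι ℂ) (γ : ℕ → ℝ) :
    ℕ → Matrix ι ι ℂ
  | 0 => S0
  | k + 1 => riccStep A C Q R (γ k) (ricc A C Q R S0 γ k)

/-- Loewner order: `X ≤ Y` iff `Y - X` is positive semidefinite. -/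
def loe {ι : Type} [Fintype ι] (X Y : Matrix ι ι ℂ) : Prop := (Y - X).PosSemidef

/-- Entrywise expectation of a random matrix. -/
noncomputable def matExp {Ω ι κ : Type} [MeasurableSpace Ω] (μ : Measure Ω)
    (X : Ω → Matrix ι κ ℂ) : Matrix ι κ ℂ :=
  Matrix.of fun i j => ∫ ω, X ω i j ∂μ

/-- `sup_k E[P_k]` is bounded: the entries are integrable and there is a Hermitian matrix `M`
dominating every `E[P_k]` in the Loewner order. -/
def EBounded {Ω ι : Type} [Fintype ι] [MeasurableSpace Ω] (μ : Measure Ω)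
    (P : ℕ → Ω → Matrix ι ι ℂ) : Prop :=
  (∀ k i j, Integrable (fun ω => P k ω i j) μ) ∧
  ∃ M : Matrix ι ι ℂ, M.IsHermitian ∧ ∀ k, loe (matExp μ (P k)) M

/-- PBH detectability of `(C, A)`. -/
def Detectable {ι κ : Type} [Fintype ι] [Fintype κ] [DecidableEq ι]
    (A : Matrix ι ι ℂ) (C : Matrix κ ι ℂ) : Prop :=
  ∀ z : ℂ, 1 ≤ ‖z‖ →
    (Matrix.fromRows (A - z • (1 : Matrix ι ι ℂ)) C).rank = Fintype.card ι

/-- Non-degeneracy: for each equi-modulus index set `{j | |d j| = r}` the corresponding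
columns of `C` are linearly independent (i.e. `rank C_I = |I|`). -/
def NonDeg {ι κ : Type} (d : ι → ℂ) (C : Matrix κ ι ℂ) : Prop :=
  ∀ r : ℝ, LinearIndependent ℂ
    (fun j : {j : ι // ‖d j‖ = r} => fun i : κ => C i j.1)


section Aux

set_option linter.unusedSectionVars false

variable {ι κ : Type} [Fintype ι] [Fintype κ] [DecidableEq ι] [DecidableEq κ]

theorem ricc_square {α : Type} [Fintype α] (A : Matrix ι ι ℂ) (C : Matrix κ ι ℂ)
    (Q : Matrix ι ι ℂ) (R : Matrix κ κ ℂ) (hR : R.PosDef) (X : Matrix ι ι ℂ) (hX : X.PosSemidef)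
    (V : Matrix ι α ℂ) (H : Matrix κ α ℂ) :
    Vᴴ * riccStep A C Q R 1 X * V
      + (H - (C * X * Cᴴ + R)⁻¹ * (C * X * Aᴴ * V))ᴴ * (C * X * Cᴴ + R)
        * (H - (C * X * Cᴴ + R)⁻¹ * (C * X * Aᴴ * V))
      = (Aᴴ * V - Cᴴ * H)ᴴ * X * (Aᴴ * V - Cᴴ * H) + Vᴴ * Q * V + Hᴴ * R * H := by
  have hS : (C * X * Cᴴ + R).PosDef := by
    refine Matrix.PosDef.posSemidef_add ?_ hR
    exact hX.mul_mul_conjTranspose_same C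
  have hu : IsUnit (C * X * Cᴴ + R) := hS.isUnit
  have hSh : (C * X * Cᴴ + R)ᴴ = C * X * Cᴴ + R := hS.isHermitian
  have hXh : Xᴴ = X := hX.isHermitian
  have hdet := (Matrix.isUnit_iff_isUnit_det _).1 hu
  obtain ⟨S, hSd⟩ : ∃ S, S = C * X * Cᴴ + R := ⟨_, rfl⟩
  have hRS : R = S - C * X * Cᴴ := by rw [hSd]; abel
  unfold riccStep
  rw [← hSd] at hSh hdet ⊢
  have hih : (S⁻¹)ᴴ = S⁻¹ := by rw [Matrix.conjTranspose_nonsing_inv, hSh]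
  have e1 : ∀ M : Matrix κ α ℂ, S * (S⁻¹ * M) = M := fun M =>
    Matrix.mul_nonsing_inv_cancel_left S M hdet
  have e2 : ∀ M : Matrix κ α ℂ, S⁻¹ * (S * M) = M := fun M =>
    Matrix.nonsing_inv_mul_cancel_left S M hdet
  rw [hRS]
  simp only [Complex.ofReal_one, one_smul, Matrix.conjTranspose_sub, Matrix.conjTranspose_mul,
    Matrix.conjTranspose_conjTranspose, hih, hXh, Matrix.mul_sub, Matrix.sub_mul, Matrix.mul_add,
    Matrix.add_mul, Matrix.mul_assoc, e1, e2]
  abel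

theorem riccStep_zero (A : Matrix ι ι ℂ) (C : Matrix κ ι ℂ)
    (Q : Matrix ι ι ℂ) (R : Matrix κ κ ℂ) (X : Matrix ι ι ℂ) :
    riccStep A C Q R 0 X = A * X * Aᴴ + Q := by
  simp [riccStep]

theorem riccStep_psd (A : Matrix ι ι ℂ) (C : Matrix κ ι ℂ)
    (Q : Matrix ι ι ℂ) (R : Matrix κ κ ℂ) (hQ : Q.PosDef) (hR : R.PosDef) (X : Matrix ι ι ℂ)
    (hX : X.PosSemidef) (g : ℝ) (hg : g = 0 ∨ g = 1) : (riccStep A C Q R g X).PosSemidef := by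
  rcases hg with rfl | rfl
  · rw [riccStep_zero]
    exact (hX.mul_mul_conjTranspose_same A).add hQ.posSemidef
  · have h := ricc_square A C Q R hR X hX (1 : Matrix ι ι ℂ)
      ((C * X * Cᴴ + R)⁻¹ * (C * X * Aᴴ * (1 : Matrix ι ι ℂ)))
    simp only [sub_self, Matrix.mul_zero, add_zero, Matrix.conjTranspose_one, Matrix.one_mul,
      Matrix.mul_one] at h
    rw [h]
    exact ((hX.conjTranspose_mul_mul_same _).add hQ.posSemidef).add
      (hR.posSemidef.conjTranspose_mul_mul_same _)

theorem ricc_psd (A : Matrix ι ι ℂ) (C : Matrix κ ι ℂ)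
    (Q : Matrix ι ι ℂ) (R : Matrix κ κ ℂ) (hQ : Q.PosDef) (hR : R.PosDef) (S0 : Matrix ι ι ℂ)
    (hS : S0.PosSemidef) (g : ℕ → ℝ) (hg : ∀ k, g k = 0 ∨ g k = 1) (k : ℕ) :
    (ricc A C Q R S0 g k).PosSemidef := by
  induction k with
  | zero => exact hS
  | succ k ih => exact riccStep_psd A C Q R hQ hR _ ih _ (hg k)

/-- real quadratic form -/
noncomputable def qfm (X : Matrix ι ι ℂ) (v : ι → ℂ) : ℝ := (star v ⬝ᵥ (X *ᵥ v)).re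

theorem qfm_nonneg {X : Matrix ι ι ℂ} (hX : X.PosSemidef) (v : ι → ℂ) : 0 ≤ qfm X v :=
  (Complex.le_def.1 (hX.dotProduct_mulVec_nonneg v)).1

theorem qfm_add (X Y : Matrix ι ι ℂ) (v : ι → ℂ) : qfm (X + Y) v = qfm X v + qfm Y v := by
  simp [qfm, Matrix.add_mulVec, dotProduct_add]

theorem qfm_conj (X : Matrix ι ι ℂ) (B : Matrix κ ι ℂ) (v : κ → ℂ) :
    qfm (B * X * Bᴴ) v = qfm X (Bᴴ *ᵥ v) := by
  unfold qfm
  congr 1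
  rw [← Matrix.mulVec_mulVec, ← Matrix.mulVec_mulVec, Matrix.dotProduct_mulVec, Matrix.star_mulVec,
    Matrix.conjTranspose_conjTranspose]

theorem qfm_col (X : Matrix ι ι ℂ) (v : ι → ℂ) :
    (((Matrix.replicateCol Unit v)ᴴ * X * Matrix.replicateCol Unit v) () ()).re = qfm X v := by
  unfold qfm
  rw [Matrix.mul_assoc]
  simp [Matrix.mul_apply, dotProduct, Matrix.mulVec]

theorem qfm_step_one (A : Matrix ι ι ℂ) (C : Matrix κ ι ℂ)
    (Q : Matrix ι ι ℂ) (R : Matrix κ κ ℂ) (hR : R.PosDef) (X : Matrix ι ι ℂ) (hX : X.PosSemidef)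
    (v : ι → ℂ) (η : κ → ℂ) :
    qfm (riccStep A C Q R 1 X) v ≤ qfm X (Aᴴ *ᵥ v - Cᴴ *ᵥ η) + qfm Q v + qfm R η := by
  have h := ricc_square A C Q R hR X hX (Matrix.replicateCol Unit v) (Matrix.replicateCol Unit η)
  have hS : (C * X * Cᴴ + R).PosDef :=
    Matrix.PosDef.posSemidef_add (hX.mul_mul_conjTranspose_same C) hR
  have e1 : Aᴴ * Matrix.replicateCol Unit v - Cᴴ * Matrix.replicateCol Unit η
      = Matrix.replicateCol Unit (Aᴴ *ᵥ v - Cᴴ *ᵥ η) := by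
    ext i j
    simp [Matrix.mul_apply, Matrix.mulVec, dotProduct]
  have e2 : Matrix.replicateCol Unit η - (C * X * Cᴴ + R)⁻¹ * (C * X * Aᴴ * Matrix.replicateCol Unit v)
      = Matrix.replicateCol Unit (η - (C * X * Cᴴ + R)⁻¹ *ᵥ ((C * X * Aᴴ) *ᵥ v)) := by
    ext i j
    generalize (C * X * Cᴴ + R)⁻¹ = T
    generalize C * X * Aᴴ = U
    simp only [Matrix.sub_apply, Matrix.mul_apply, Matrix.replicateCol_apply, Pi.sub_apply,
      Matrix.mulVec, dotProduct]
  rw [e1, e2] at h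
  have h' := congrArg (fun M : Matrix Unit Unit ℂ => (M () ()).re) h
  simp only [Matrix.add_apply, Complex.add_re, qfm_col] at h'
  have := qfm_nonneg hS.posSemidef (η - (C * X * Cᴴ + R)⁻¹ *ᵥ ((C * X * Aᴴ) *ᵥ v))
  linarith

theorem qfm_step (A : Matrix ι ι ℂ) (C : Matrix κ ι ℂ)
    (Q : Matrix ι ι ℂ) (R : Matrix κ κ ℂ) (hR : R.PosDef) (X : Matrix ι ι ℂ) (hX : X.PosSemidef)
    (g : ℝ) (hg : g = 0 ∨ g = 1) (v : ι → ℂ) :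
    qfm (riccStep A C Q R g X) v ≤ qfm X (Aᴴ *ᵥ v) + qfm Q v := by
  rcases hg with rfl | rfl
  · rw [riccStep_zero, qfm_add, qfm_conj]
  · have := qfm_step_one A C Q R hR X hX v 0
    simpa [qfm] using this

theorem qfm_bound (X : Matrix (Fin 2) (Fin 2) ℂ) :
    ∃ K : ℝ, 0 ≤ K ∧ ∀ x y : ℂ, qfm X ![x, y] ≤ K * (‖x‖ ^ 2 + ‖y‖ ^ 2) := by
  refine ⟨‖X 0 0‖ + ‖X 0 1‖ + ‖X 1 0‖ + ‖X 1 1‖, by positivity, fun x y => ?_⟩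
  unfold qfm
  refine (Complex.re_le_norm _).trans ?_
  have : star ![x, y] ⬝ᵥ (X *ᵥ ![x, y]) = star x * X 0 0 * x + star x * X 0 1 * y
      + star y * X 1 0 * x + star y * X 1 1 * y := by
    simp [dotProduct, Matrix.mulVec, Fin.sum_univ_two]
    ring
  rw [this]
  refine (norm_add₄_le).trans ?_
  simp only [norm_mul, norm_star]
  have hx := norm_nonneg x
  have hy := norm_nonneg y
  have h1 : ‖x‖ * ‖y‖ ≤ ‖x‖ ^ 2 + ‖y‖ ^ 2 := by nlinarith [sq_nonneg (‖x‖ - ‖y‖), sq_nonneg (‖x‖ + ‖y‖)]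
  have h2 : ‖x‖ ^ 2 ≤ ‖x‖ ^ 2 + ‖y‖ ^ 2 := by nlinarith
  have h3 : ‖y‖ ^ 2 ≤ ‖x‖ ^ 2 + ‖y‖ ^ 2 := by nlinarith
  nlinarith [mul_le_mul_of_nonneg_left h1 (norm_nonneg (X 0 1)),
    mul_le_mul_of_nonneg_left h1 (norm_nonneg (X 1 0)),
    mul_le_mul_of_nonneg_left h2 (norm_nonneg (X 0 0)),
    mul_le_mul_of_nonneg_left h3 (norm_nonneg (X 1 1))]

end Aux

section Det

/-- abstract dual value function inequalities -/
theorem det_iter (a1 a2 : ℂ) (L : ℝ) (hL : 1 < L) (ha1 : ‖a1‖ ^ 2 = L) (ha2 : ‖a2‖ ^ 2 = L)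
    (q : ℝ) (V : ℕ → ℂ → ℂ → ℝ)
    (h1 : ∀ k x y, V (k + 1) x y ≤ V k (a1 * x) (a2 * y) + q * (‖x‖ ^ 2 + ‖y‖ ^ 2))
    (k n : ℕ) : ∀ x y, V (k + n) x y ≤ V k (a1 ^ n * x) (a2 ^ n * y)
      + q * ((L ^ n - 1) / (L - 1)) * (‖x‖ ^ 2 + ‖y‖ ^ 2) := by
  have hL' : L - 1 ≠ 0 := by linarith
  induction n with
  | zero => intro x y; simp
  | succ n ih =>
    intro x y
    have e1 := h1 (k + n) x y
    have e2 := ih (a1 * x) (a2 * y)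
    rw [← mul_assoc, ← mul_assoc, ← pow_succ, ← pow_succ, norm_mul, norm_mul, mul_pow, mul_pow,
      ha1, ha2] at e2
    have : q * ((L ^ (n + 1) - 1) / (L - 1)) * (‖x‖ ^ 2 + ‖y‖ ^ 2)
      = q * ((L ^ n - 1) / (L - 1)) * (L * ‖x‖ ^ 2 + L * ‖y‖ ^ 2) + q * (‖x‖ ^ 2 + ‖y‖ ^ 2) := by
      field_simp
      ring
    rw [← add_assoc, this]
    linarith

theorem det_ctrl (a1 a2 c1 c2 : ℂ) (L : ℝ) (hL : 1 < L) (ha1 : ‖a1‖ ^ 2 = L) (ha2 : ‖a2‖ ^ 2 = L)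
    (q r : ℝ) (hq : 0 ≤ q) (V : ℕ → ℂ → ℂ → ℝ)
    (h1 : ∀ k x y, V (k + 1) x y ≤ V k (a1 * x) (a2 * y) + q * (‖x‖ ^ 2 + ‖y‖ ^ 2))
    (k : ℕ)
    (h2 : ∀ x y s, V (k + 1) x y ≤ V k (a1 * x - s * c1) (a2 * y - s * c2)
      + q * (‖x‖ ^ 2 + ‖y‖ ^ 2) + r * ‖s‖ ^ 2)
    (n : ℕ) (x y s : ℂ) : V (k + (n + 1)) x y ≤
      V k (a1 ^ (n + 1) * x - s * c1) (a2 ^ (n + 1) * y - s * c2)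
      + q / (L - 1) * L ^ (n + 1) * (‖x‖ ^ 2 + ‖y‖ ^ 2) + r * ‖s‖ ^ 2 := by
  have e1 := det_iter a1 a2 L hL ha1 ha2 q V h1 (k + 1) n x y
  have e2 := h2 (a1 ^ n * x) (a2 ^ n * y) s
  have hn1 : ‖a1 ^ n * x‖ ^ 2 = L ^ n * ‖x‖ ^ 2 := by
    rw [norm_mul, norm_pow, mul_pow, ← pow_mul, mul_comm n 2, pow_mul, ha1]
  have hn2 : ‖a2 ^ n * y‖ ^ 2 = L ^ n * ‖y‖ ^ 2 := by
    rw [norm_mul, norm_pow, mul_pow, ← pow_mul, mul_comm n 2, pow_mul, ha2]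
  rw [hn1, hn2, ← mul_assoc, ← mul_assoc, ← pow_succ', ← pow_succ'] at e2
  rw [show k + (n + 1) = k + 1 + n by ring]
  have hL0 : 0 < L - 1 := by linarith
  have : q * ((L ^ n - 1) / (L - 1)) * (‖x‖ ^ 2 + ‖y‖ ^ 2) + q * (L ^ n * ‖x‖ ^ 2 + L ^ n * ‖y‖ ^ 2)
    = q / (L - 1) * L ^ (n + 1) * (‖x‖ ^ 2 + ‖y‖ ^ 2) - q / (L - 1) * (‖x‖ ^ 2 + ‖y‖ ^ 2) := by
    field_simp
    ring
  have h4 : 0 ≤ q / (L - 1) * (‖x‖ ^ 2 + ‖y‖ ^ 2) := by positivity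
  linarith

theorem norm_sub_sq_le (a b : ℂ) : ‖a - b‖ ^ 2 ≤ 2 * ‖a‖ ^ 2 + 2 * ‖b‖ ^ 2 := by
  have := norm_sub_le a b
  have h0 := norm_nonneg (a - b)
  nlinarith [sq_nonneg (‖a‖ - ‖b‖)]

theorem det_pair (a1 a2 z c1 c2 : ℂ) (L : ℝ) (hL : 1 < L) (ha1 : ‖a1‖ ^ 2 = L) (ha2 : ‖a2‖ ^ 2 = L)
    (haz : a2 = a1 * z) (hz : ‖z‖ = 1) (hc1 : c1 ≠ 0) (hc2 : c2 ≠ 0)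
    (q r ε : ℝ) (hq : 0 ≤ q) (hr : 0 ≤ r) (hε : 0 < ε) :
    ∃ K : ℝ, 0 ≤ K ∧ ∀ (V : ℕ → ℂ → ℂ → ℝ) (g : ℕ → ℝ)
    (_ : ∀ k x y, V (k + 1) x y ≤ V k (a1 * x) (a2 * y) + q * (‖x‖ ^ 2 + ‖y‖ ^ 2))
    (_ : ∀ k, g k = 1 → ∀ x y s, V (k + 1) x y ≤ V k (a1 * x - s * c1) (a2 * y - s * c2)
      + q * (‖x‖ ^ 2 + ‖y‖ ^ 2) + r * ‖s‖ ^ 2)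
    (_ : ∀ k, V k 0 0 = 0)
    (t d a : ℕ) (_ : g t = 1) (_ : g (t + (d + 1)) = 1) (_ : ε ≤ ‖z ^ (d + 1) - 1‖) (x y : ℂ),
    V (t + (d + 1) + (a + 1)) x y ≤ K * (‖x‖ ^ 2 + ‖y‖ ^ 2) * L ^ (d + 1 + (a + 1)) := by
  have hL0 : 0 < L - 1 := by linarith
  set b : ℝ := ‖c1‖⁻¹ ^ 2 + ‖c2‖⁻¹ ^ 2 with hb
  have hb0 : 0 ≤ b := by positivity
  -- bounds: |s|^2 ≤ Ks * n, |s'|^2 ≤ L^d * Ks' * n, N ≤ Kn * n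
  set Ks : ℝ := (2 * b) / ε ^ 2 with hKs
  have hKs0 : 0 ≤ Ks := by positivity
  set Kn : ℝ := 2 + 2 * Ks * (‖c1‖ ^ 2 + ‖c2‖ ^ 2) with hKn
  have hKn0 : 0 ≤ Kn := by positivity
  set Kt : ℝ := 2 * b + 2 * Ks with hKt
  have hKt0 : 0 ≤ Kt := by positivity
  have hqL : 0 ≤ q / (L - 1) := by positivity
  refine ⟨q / (L - 1) + r * Ks + q / (L - 1) * Kn + r * Kt, by positivity, ?_⟩
  intro V g h1 h2 h0 t d a hg1 hg2 hgood x y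
  have s1 := fun s => det_ctrl a1 a2 c1 c2 L hL ha1 ha2 q r hq V h1 (t + (d + 1)) (h2 _ hg2) a x y s
  set X := a1 ^ (a + 1) * x with hX
  set Y := a2 ^ (a + 1) * y with hY
  have hXn : ‖X‖ ^ 2 = L ^ (a + 1) * ‖x‖ ^ 2 := by
    rw [hX, norm_mul, norm_pow, mul_pow, ← pow_mul, mul_comm _ 2, pow_mul, ha1]
  have hYn : ‖Y‖ ^ 2 = L ^ (a + 1) * ‖y‖ ^ 2 := by
    rw [hY, norm_mul, norm_pow, mul_pow, ← pow_mul, mul_comm _ 2, pow_mul, ha2]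
  set n : ℝ := ‖x‖ ^ 2 + ‖y‖ ^ 2 with hn
  have hn0 : 0 ≤ n := by positivity
  set Z := z ^ (d + 1) with hZ
  have hZn : ‖Z‖ = 1 := by rw [hZ, norm_pow, hz, one_pow]
  have hZ1 : Z - 1 ≠ 0 := by
    intro h; rw [h, norm_zero] at hgood; linarith
  set s := (Z * Y / c2 - X / c1) / (Z - 1) with hs
  set s' := a1 ^ (d + 1) * (X / c1 - s) with hs'
  have s2 := det_ctrl a1 a2 c1 c2 L hL ha1 ha2 q r hq V h1 t (h2 _ hg1) d
    (X - s * c1) (Y - s * c2) s'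
  have e1 : a1 ^ (d + 1) * (X - s * c1) - s' * c1 = 0 := by
    rw [hs']; field_simp; ring
  have e2 : a2 ^ (d + 1) * (Y - s * c2) - s' * c2 = 0 := by
    have hss : s * (Z - 1) = Z * Y / c2 - X / c1 := by rw [hs]; field_simp
    have : Z * (Y / c2 - s) = X / c1 - s := by linear_combination -hss
    rw [hs', haz, mul_pow, ← hZ, ← this]; field_simp; ring
  rw [e1, e2, h0] at s2
  have P : 0 ≤ L ^ (a + 1) := by positivity
  have XYb : ‖X‖ ^ 2 + ‖Y‖ ^ 2 = L ^ (a + 1) * n := by rw [hXn, hYn, hn]; ring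
  have i1 : ‖X / c1‖ ^ 2 ≤ ‖c1‖⁻¹ ^ 2 * (L ^ (a + 1) * n) := by
    rw [div_eq_mul_inv, norm_mul, norm_inv, mul_pow, mul_comm]
    apply mul_le_mul_of_nonneg_left _ (by positivity)
    nlinarith [sq_nonneg ‖Y‖]
  have i2 : ‖Z * Y / c2‖ ^ 2 ≤ ‖c2‖⁻¹ ^ 2 * (L ^ (a + 1) * n) := by
    rw [div_eq_mul_inv, norm_mul, norm_mul, hZn, one_mul, norm_inv, mul_pow, mul_comm]
    apply mul_le_mul_of_nonneg_left _ (by positivity)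
    nlinarith [sq_nonneg ‖X‖]
  have i3 : ‖s‖ ^ 2 ≤ Ks * (L ^ (a + 1) * n) := by
    rw [hs, norm_div, div_pow, hKs]
    have := norm_sub_sq_le (Z * Y / c2) (X / c1)
    rw [div_mul_eq_mul_div]
    apply div_le_div₀ (by positivity) _ (by positivity) (by gcongr)
    rw [hb]; linarith
  have i4 : ‖s'‖ ^ 2 ≤ L ^ (d + 1) * (Kt * (L ^ (a + 1) * n)) := by
    rw [hs', norm_mul, norm_pow, mul_pow, ← pow_mul, mul_comm _ 2, pow_mul, ha1]
    apply mul_le_mul_of_nonneg_left _ (by positivity)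
    have := norm_sub_sq_le (X / c1) s
    have h5 : ‖c1‖⁻¹ ^ 2 * (L ^ (a + 1) * n) ≤ b * (L ^ (a + 1) * n) := by
      gcongr; rw [hb]; linarith [sq_nonneg ‖c2‖⁻¹]
    rw [hKt]; linarith
  have i5 : ‖X - s * c1‖ ^ 2 + ‖Y - s * c2‖ ^ 2 ≤ Kn * (L ^ (a + 1) * n) := by
    have u1 := norm_sub_sq_le X (s * c1)
    have u2 := norm_sub_sq_le Y (s * c2)
    rw [norm_mul s, mul_pow] at u1 u2
    have u3 := mul_le_mul_of_nonneg_right i3 (show 0 ≤ ‖c1‖ ^ 2 + ‖c2‖ ^ 2 by positivity)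
    rw [hKn]
    linarith
  have s1' := s1 s
  have j1 := mul_le_mul_of_nonneg_left i3 hr
  have j2 := mul_le_mul_of_nonneg_left i4 hr
  have j3 := mul_le_mul_of_nonneg_left i5 (show 0 ≤ q / (L - 1) * L ^ (d + 1) by positivity)
  have hLd : 1 ≤ L ^ (d + 1) := one_le_pow₀ hL.le
  have j4 : (q / (L - 1) + r * Ks) * (L ^ (a + 1) * n) ≤
     (q / (L - 1) + r * Ks) * (L ^ (a + 1) * n) * L ^ (d + 1) :=
    le_mul_of_one_le_right (by positivity) hLd
  rw [pow_add L (d + 1) (a + 1)]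
  linarith

/-- bookkeeping of the last `n` slots -/
theorem det_sum (k : ℕ) (g : ℕ → ℝ) (hg : ∀ k, g k = 0 ∨ g k = 1) (L K W : ℝ) (hL : 1 < L)
    (hK : 0 ≤ K) (good : ℕ → Prop)
    (hpair : ∀ a j, 1 ≤ a → a < j → j ≤ k → g (k - a) = 1 → g (k - j) = 1 → good (j - a) →
      W ≤ K * L ^ j)
    (hend : W ≤ K * L ^ k) (S : ℕ → ℕ → Finset ℕ)
    (hS : ∀ n a j, j ∈ S n a → 1 ≤ j ∧ j ≤ n ∧ j ≠ a ∧ (a < j → good (j - a)))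
    (ind : ℕ → ℕ → ℝ) (hind0 : ∀ n a, 0 ≤ ind n a)
    (hind : ∀ n a, (∀ j ∈ S n a, g (k - j) = 0) → 1 ≤ ind n a) :
    W ≤ K * L * (1 + ∑ n ∈ Finset.range k, L ^ n * ∑ a ∈ Finset.Icc 1 n, ind n a) := by
  classical
  have hL0 : 0 < L := by linarith
  have hterm : ∀ n, 0 ≤ L ^ n * ∑ a ∈ Finset.Icc 1 n, ind n a := fun n =>
    mul_nonneg (by positivity) (Finset.sum_nonneg fun a _ => hind0 n a)
  have hsum0 : 0 ≤ ∑ n ∈ Finset.range k, L ^ n * ∑ a ∈ Finset.Icc 1 n, ind n a :=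
    Finset.sum_nonneg fun n _ => hterm n
  have hex : ∃ n, (k ≤ n ∨ ∃ a j, 1 ≤ a ∧ a < j ∧ j ≤ n ∧ j ≤ k ∧ g (k - a) = 1 ∧ g (k - j) = 1 ∧
    good (j - a)) := ⟨k, Or.inl le_rfl⟩
  have hsp := Nat.find_spec hex
  have hmin := fun m => Nat.find_min hex (m := m)
  generalize Nat.find hex = T at hsp hmin
  have hW : W ≤ K * L ^ T := by
    rcases hsp with h | ⟨a, j, h1, h2, h3, h4, h5, h6, h7⟩
    · exact hend.trans (mul_le_mul_of_nonneg_left (pow_le_pow_right₀ hL.le h) hK)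
    · exact (hpair a j h1 h2 h4 h5 h6 h7).trans
        (mul_le_mul_of_nonneg_left (pow_le_pow_right₀ hL.le h3) hK)
  have hKL : 0 ≤ K * L := by positivity
  have hKL1 : K ≤ K * L := le_mul_of_one_le_right hK hL.le
  rcases T with _ | n
  · simp at hW
    nlinarith
  · have hn := hmin n (Nat.lt_succ_self n)
    push Not at hn
    obtain ⟨hnk, hno⟩ := hn
    rw [pow_succ, mul_comm (L ^ n), ← mul_assoc] at hW
    refine hW.trans (mul_le_mul_of_nonneg_left ?_ hKL)
    rcases Nat.eq_zero_or_pos n with rfl | hpos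
    · simp; simpa using hsum0
    · have hx : ∃ a ∈ Finset.Icc 1 n, 1 ≤ ind n a := by
        by_cases hall : ∃ a, 1 ≤ a ∧ a ≤ n ∧ g (k - a) = 1
        · have hf := Nat.find_spec hall
          have hm := fun m => Nat.find_min hall (m := m)
          generalize Nat.find hall = a at hf hm
          refine ⟨a, Finset.mem_Icc.2 ⟨hf.1, hf.2.1⟩, hind n a fun j hj => ?_⟩
          obtain ⟨h1, h2, h3, h4⟩ := hS n a j hj
          rcases hg (k - j) with h | h
          · exact h
          · exfalso
            rcases lt_or_gt_of_ne h3 with h5 | h5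
            · exact hm j h5 ⟨h1, h2, h⟩
            · exact hno a j hf.1 h5 h2 (h2.trans hnk.le) hf.2.2 h (h4 h5)
        · push Not at hall
          refine ⟨n, Finset.mem_Icc.2 ⟨hpos, le_rfl⟩, hind n n fun j hj => ?_⟩
          obtain ⟨h1, h2, h3, h4⟩ := hS n n j hj
          exact (hg (k - j)).resolve_right (hall j h1 h2)
      obtain ⟨a, ha, hia⟩ := hx
      have u1 : 1 ≤ ∑ a ∈ Finset.Icc 1 n, ind n a :=
        hia.trans (Finset.single_le_sum (f := ind n) (fun a _ => hind0 n a) ha)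
      have u2 : L ^ n ≤ L ^ n * ∑ a ∈ Finset.Icc 1 n, ind n a :=
        le_mul_of_one_le_right (by positivity) u1
      have u3 := Finset.single_le_sum (f := fun n => L ^ n * ∑ a ∈ Finset.Icc 1 n, ind n a)
        (fun n _ => hterm n) (Finset.mem_range.2 hnk)
      linarith

end Det

section Count

theorem gap_eps (z : ℂ) (hz : ∀ d : ℕ, 1 ≤ d → z ^ d ≠ 1) (N : ℕ) :
    ∃ ε : ℝ, 0 < ε ∧ ∀ d : ℕ, 1 ≤ d → d < N → 2 * ε ≤ ‖z ^ d - 1‖ := by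
  induction N with
  | zero => exact ⟨1, one_pos, fun d _ h => absurd h (Nat.not_lt_zero d)⟩
  | succ N ih =>
    obtain ⟨ε, hε, h⟩ := ih
    rcases Nat.eq_zero_or_pos N with rfl | hN
    · exact ⟨1, one_pos, fun d h1 h2 => by omega⟩
    have hp : 0 < ‖z ^ N - 1‖ := norm_pos_iff.2 (sub_ne_zero.2 (hz N hN))
    refine ⟨min ε (‖z ^ N - 1‖ / 2), by positivity, fun d h1 h2 => ?_⟩
    rcases Nat.lt_succ_iff_lt_or_eq.1 h2 with h3 | rfl
    · have := h d h1 h3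
      have := min_le_left ε (‖z ^ N - 1‖ / 2)
      linarith
    · have := min_le_right ε (‖z ^ d - 1‖ / 2)
      linarith

open Classical in
noncomputable def Sset (good : ℕ → Prop) (n a : ℕ) : Finset ℕ :=
  (Finset.Icc 1 n).filter (fun j => j ≠ a ∧ (a < j → good (j - a)))

theorem card_Sset (z : ℂ) (hz1 : ‖z‖ = 1) (N : ℕ) (hN : 1 ≤ N) (ε : ℝ)
    (hε : ∀ d : ℕ, 1 ≤ d → d < N → 2 * ε ≤ ‖z ^ d - 1‖) (n a : ℕ) :
    n ≤ (Sset (fun d => ε ≤ ‖z ^ d - 1‖) n a).card + n / N + 2 := by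
  classical
  set B := (Finset.Icc 1 n).filter (fun j => a < j ∧ ¬ (ε ≤ ‖z ^ (j - a) - 1‖)) with hB
  have key : ∀ d e : ℕ, d < e → e < d + N → ¬ (ε ≤ ‖z ^ d - 1‖) → ¬ (ε ≤ ‖z ^ e - 1‖) → False := by
    intro d e h1 h2 h3 h4
    push Not at h3 h4
    have h5 := hε (e - d) (by omega) (by omega)
    have h6 : z ^ e - z ^ d = z ^ d * (z ^ (e - d) - 1) := by
      rw [mul_sub, ← pow_add, mul_one]; congr 2; omega
    have h7 : ‖z ^ e - z ^ d‖ = ‖z ^ (e - d) - 1‖ := by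
      rw [h6, norm_mul, norm_pow, hz1, one_pow, one_mul]
    have h8 : ‖z ^ e - z ^ d‖ ≤ ‖z ^ e - 1‖ + ‖z ^ d - 1‖ := by
      have : z ^ e - z ^ d = (z ^ e - 1) - (z ^ d - 1) := by ring
      rw [this]; exact norm_sub_le _ _
    linarith
  have hBc : B.card ≤ n / N + 1 := by
    have : B.card ≤ (Finset.range (n / N + 1)).card := by
      refine Finset.card_le_card_of_injOn (fun j => (j - a) / N) ?_ ?_
      · intro j hj
        simp only [hB, Finset.coe_filter, Finset.mem_Icc, Set.mem_ofPred_eq] at hj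
        simp only [Finset.coe_range, Set.mem_Iio]
        have : (j - a) / N ≤ n / N := Nat.div_le_div_right (by omega)
        omega
      · intro j hj j' hj' hjj
        simp only [hB, Finset.coe_filter, Finset.mem_Icc, Set.mem_ofPred_eq] at hj hj'
        simp only at hjj
        have u1 := Nat.div_add_mod (j - a) N
        have u2 := Nat.div_add_mod (j' - a) N
        have u3 := Nat.mod_lt (j - a) hN
        have u4 := Nat.mod_lt (j' - a) hN
        rw [hjj] at u1
        by_contra hne
        rcases lt_or_gt_of_ne hne with h | h
        · exact key (j - a) (j' - a) (by omega) (by omega) hj.2.2 hj'.2.2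
        · exact key (j' - a) (j - a) (by omega) (by omega) hj'.2.2 hj.2.2
    simpa using this
  have hsub : Finset.Icc 1 n ⊆ Sset (fun d => ε ≤ ‖z ^ d - 1‖) n a ∪ (insert a B) := by
    intro j hj
    simp only [Sset, hB, Finset.mem_union, Finset.mem_filter, Finset.mem_insert]
    by_cases h1 : j = a
    · exact Or.inr (Or.inl h1)
    · by_cases h2 : a < j → ε ≤ ‖z ^ (j - a) - 1‖
      · exact Or.inl ⟨hj, h1, h2⟩
      · rw [Classical.not_imp] at h2
        exact Or.inr (Or.inr ⟨hj, h2⟩)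
  have h1 := Finset.card_le_card hsub
  have h2 := Finset.card_union_le (Sset (fun d => ε ≤ ‖z ^ d - 1‖) n a) (insert a B)
  have h3 := Finset.card_insert_le a B
  rw [Nat.card_Icc] at h1
  omega

theorem num_bound (L q : ℝ) (hL : 1 < L) (hq : 0 ≤ q) (hqL : q * L < 1) :
    ∃ N : ℕ, 1 ≤ N ∧ ∃ B : ℝ, 0 ≤ B ∧ ∀ c : ℕ → ℕ → ℕ, (∀ n a, n ≤ c n a + n / N + 2) →
      ∀ k, ∑ n ∈ Finset.range k, L ^ n * ∑ a ∈ Finset.Icc 1 n, q ^ (c n a) ≤ B := by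
  have hL0 : 0 < L := by linarith
  obtain ⟨q', hq'0, hqq', hq'L⟩ : ∃ q' : ℝ, 0 < q' ∧ q ≤ q' ∧ q' * L < 1 := by
    refine ⟨max q (1 / (2 * L)), by positivity, le_max_left _ _, ?_⟩
    rcases max_choice q (1 / (2 * L)) with h | h <;> rw [h]
    · exact hqL
    · field_simp; norm_num
  have hq'1 : q' ≤ 1 := by nlinarith
  have ht : Filter.Tendsto (fun N : ℕ => L * q' ^ (1 - 1 / ((N : ℝ) + 1))) Filter.atTop
      (nhds (L * q' ^ (1 - (0 : ℝ)))) := by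
    have h1 : Filter.Tendsto (fun N : ℕ => (1 : ℝ) - 1 / ((N : ℝ) + 1)) Filter.atTop
        (nhds (1 - 0)) := tendsto_const_nhds.sub tendsto_one_div_add_atTop_nhds_zero_nat
    exact (((Real.continuous_const_rpow hq'0.ne').tendsto _).comp h1).const_mul L
  have hlt : L * q' ^ (1 - (0 : ℝ)) < 1 := by
    rw [sub_zero, Real.rpow_one]; linarith
  obtain ⟨M, hM⟩ := (ht.eventually (gt_mem_nhds hlt)).exists
  set β : ℝ := q' ^ (1 - 1 / ((M : ℝ) + 1)) with hβ
  have hβ0 : 0 < β := Real.rpow_pos_of_pos hq'0 _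
  have hsm : Summable (fun n : ℕ => (n : ℝ) ^ 1 * (L * β) ^ n) :=
    summable_pow_mul_geometric_of_norm_lt_one 1 (by
      rw [Real.norm_eq_abs, abs_of_pos (by positivity)]; exact hM)
  refine ⟨M + 1, by omega, q' ^ (-2 : ℝ) * ∑' n : ℕ, (n : ℝ) ^ 1 * (L * β) ^ n, ?_, ?_⟩
  · exact mul_nonneg (Real.rpow_nonneg hq'0.le _) (tsum_nonneg fun n => by positivity)
  intro c hc k
  have hterm : ∀ n a, q ^ (c n a) ≤ q' ^ (-2 : ℝ) * β ^ n := by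
    intro n a
    have h1 : q ^ (c n a) ≤ q' ^ (c n a) := pow_le_pow_left₀ hq hqq' _
    have h2 : q' ^ (-2 : ℝ) * β ^ n = q' ^ ((-2 : ℝ) + (1 - 1 / ((M : ℝ) + 1)) * n) := by
      rw [Real.rpow_add hq'0, Real.rpow_mul hq'0.le, Real.rpow_natCast]
    rw [h2]
    refine h1.trans ?_
    rw [← Real.rpow_natCast]
    apply Real.rpow_le_rpow_of_exponent_ge hq'0 hq'1
    have h3 : ((n / (M + 1) : ℕ) : ℝ) ≤ (n : ℝ) / ((M + 1 : ℕ) : ℝ) := Nat.cast_div_le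
    have h4 : (n : ℝ) ≤ (c n a : ℝ) + ((n / (M + 1) : ℕ) : ℝ) + 2 := by exact_mod_cast hc n a
    push_cast at h3 h4
    have h5 : (1 - 1 / ((M : ℝ) + 1)) * n = n - n / ((M : ℝ) + 1) := by ring
    rw [h5]
    linarith
  calc ∑ n ∈ Finset.range k, L ^ n * ∑ a ∈ Finset.Icc 1 n, q ^ (c n a)
      ≤ ∑ n ∈ Finset.range k, q' ^ (-2 : ℝ) * ((n : ℝ) ^ 1 * (L * β) ^ n) := by
        refine Finset.sum_le_sum fun n _ => ?_
        have : ∑ a ∈ Finset.Icc 1 n, q ^ (c n a) ≤ n * (q' ^ (-2 : ℝ) * β ^ n) := by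
          refine (Finset.sum_le_card_nsmul _ _ _ fun a _ => hterm n a).trans ?_
          simp
        refine (mul_le_mul_of_nonneg_left this (by positivity)).trans (le_of_eq ?_)
        rw [mul_pow]; ring
    _ = q' ^ (-2 : ℝ) * ∑ n ∈ Finset.range k, ((n : ℝ) ^ 1 * (L * β) ^ n) := by
        rw [Finset.mul_sum]
    _ ≤ _ := by
        refine mul_le_mul_of_nonneg_left ?_ (Real.rpow_nonneg hq'0.le _)
        exact hsm.sum_le_tsum _ fun n _ => by positivity

end Count

section Prob

set_option linter.unusedSectionVars false

variable {Ω : Type} [MeasurableSpace Ω] (μ : Measure Ω) [IsProbabilityMeasure μ]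

theorem prob_zero (γ : ℕ → Ω → ℝ) (p : ℝ)
    (hmeas : ∀ k, Measurable (γ k))
    (hind : iIndepFun γ μ)
    (h01 : ∀ k ω, γ k ω = 0 ∨ γ k ω = 1)
    (hber : ∀ k, μ {ω | γ k ω = 1} = ENNReal.ofReal p) (S : Finset ℕ) :
    MeasurableSet {ω | ∀ j ∈ S, γ j ω = 0} ∧
    μ.real {ω | ∀ j ∈ S, γ j ω = 0} = (1 - max p 0) ^ S.card := by
  have hset : {ω | ∀ j ∈ S, γ j ω = 0} = ⋂ j ∈ S, γ j ⁻¹' {0} := by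
    ext ω; simp
  have h0 : ∀ j, μ.real (γ j ⁻¹' {0}) = 1 - max p 0 := by
    intro j
    have hc : γ j ⁻¹' {0} = {ω | γ j ω = 1}ᶜ := by
      ext ω
      rcases h01 j ω with h | h <;> simp [h]
    have hm : MeasurableSet {ω | γ j ω = 1} := hmeas j (measurableSet_singleton 1)
    rw [hc, probReal_compl_eq_one_sub hm, measureReal_def, hber, ENNReal.toReal_ofReal']
  refine ⟨?_, ?_⟩
  · rw [hset]
    exact Finset.measurableSet_biInter _ fun j _ => hmeas j (measurableSet_singleton 0)
  · rw [hset, measureReal_def, hind.measure_inter_preimage_eq_mul S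
      (sets := fun _ => {0}) (fun _ _ => measurableSet_singleton 0), ENNReal.toReal_prod]
    exact (Finset.prod_congr rfl fun j _ => h0 j).trans (Finset.prod_const _)

theorem ricc_simple {ι κ : Type} [Fintype ι] [Fintype κ] [DecidableEq ι] [DecidableEq κ]
    (A : Matrix ι ι ℂ) (C : Matrix κ ι ℂ)
    (Q : Matrix ι ι ℂ) (R : Matrix κ κ ℂ) (S0 : Matrix ι ι ℂ) (γ : ℕ → Ω → ℝ)
    (hmeas : ∀ k, Measurable (γ k))
    (h01 : ∀ k ω, γ k ω = 0 ∨ γ k ω = 1) (k : ℕ) :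
    ∃ F : SimpleFunc Ω (Matrix ι ι ℂ), ∀ ω, F ω = ricc A C Q R S0 (fun i => γ i ω) k := by
  classical
  induction k with
  | zero => exact ⟨SimpleFunc.const Ω S0, fun ω => rfl⟩
  | succ k ih =>
    obtain ⟨F, hF⟩ := ih
    have hm : MeasurableSet {ω | γ k ω = 1} := hmeas k (measurableSet_singleton 1)
    refine ⟨SimpleFunc.piecewise {ω | γ k ω = 1} hm (F.map (riccStep A C Q R 1))
      (F.map (riccStep A C Q R 0)), fun ω => ?_⟩
    rcases h01 k ω with h | h
    · simp [SimpleFunc.piecewise_apply, ricc, h, hF]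
    · simp [SimpleFunc.piecewise_apply, ricc, h, hF]

theorem ricc_integrable {ι κ : Type} [Fintype ι] [Fintype κ] [DecidableEq ι] [DecidableEq κ]
    (A : Matrix ι ι ℂ) (C : Matrix κ ι ℂ)
    (Q : Matrix ι ι ℂ) (R : Matrix κ κ ℂ) (S0 : Matrix ι ι ℂ) (γ : ℕ → Ω → ℝ)
    (hmeas : ∀ k, Measurable (γ k))
    (h01 : ∀ k ω, γ k ω = 0 ∨ γ k ω = 1) (k : ℕ) (i j : ι) :
    Integrable (fun ω => ricc A C Q R S0 (fun i => γ i ω) k i j) μ := by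
  obtain ⟨F, hF⟩ := ricc_simple A C Q R S0 γ hmeas h01 k
  have := (F.map (fun M => M i j)).integrable_of_isFiniteMeasure (μ := μ)
  refine this.congr (Filter.Eventually.of_forall fun ω => ?_)
  simp [hF]

theorem qfm_matExp {ι : Type} [Fintype ι] (P : Ω → Matrix ι ι ℂ)
    (hP : ∀ i j, Integrable (fun ω => P ω i j) μ) (v : ι → ℂ) :
    Integrable (fun ω => qfm (P ω) v) μ ∧ qfm (matExp μ P) v = ∫ ω, qfm (P ω) v ∂μ := by
  have e : ∀ M : Matrix ι ι ℂ, star v ⬝ᵥ (M *ᵥ v) = ∑ i, ∑ j, star (v i) * (M i j * v j) := by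
    intro M
    simp only [dotProduct, Matrix.mulVec, Finset.mul_sum, Pi.star_apply]
  have hi : ∀ i j, Integrable (fun ω => star (v i) * (P ω i j * v j)) μ := fun i j =>
    ((hP i j).mul_const _).const_mul _
  have hI : Integrable (fun ω => star v ⬝ᵥ (P ω *ᵥ v)) μ := by
    simp only [e]
    exact integrable_finsetSum _ fun i _ => integrable_finsetSum _ fun j _ => hi i j
  refine ⟨hI.re, ?_⟩
  have h2 : ∫ ω, qfm (P ω) v ∂μ = (∫ ω, star v ⬝ᵥ (P ω *ᵥ v) ∂μ).re := integral_re hI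
  rw [h2]
  unfold qfm
  congr 1
  simp only [e]
  rw [integral_finsetSum _ fun i _ => integrable_finsetSum _ fun j _ => hi i j]
  refine Finset.sum_congr rfl fun i _ => ?_
  rw [integral_finsetSum _ fun j _ => hi i j]
  refine Finset.sum_congr rfl fun j _ => ?_
  rw [integral_const_mul, integral_mul_const]
  rfl

theorem matExp_herm {ι : Type} [Fintype ι] (P : Ω → Matrix ι ι ℂ)
    (hP : ∀ ω, (P ω).IsHermitian) : (matExp μ P).IsHermitian := by
  ext i j
  simp only [matExp, Matrix.conjTranspose_apply, Matrix.of_apply]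
  rw [← starRingEnd_apply, ← integral_conj]
  congr 1
  ext ω
  exact (hP ω).apply i j

end Prob

section Main

theorem col_ne_zero {m : ℕ} (l1 l2 : ℂ) (C : Matrix (Fin m) (Fin 2) ℂ)
    (h1 : 1 ≤ ‖l1‖) (h2 : 1 ≤ ‖l2‖)
    (hdet : Detectable (Matrix.diagonal ![l1, l2]) C) :
    (fun i => C i 0) ≠ 0 ∧ (fun i => C i 1) ≠ 0 := by
  have key : ∀ (z : ℂ) (j : Fin 2), 1 ≤ ‖z‖ → ![l1, l2] j = z → (fun i => C i j) ≠ 0 := by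
    intro z j hz hj h0
    have hr := hdet z hz
    rw [Matrix.rank_eq_finrank_span_cols] at hr
    have hli := linearIndependent_iff_card_eq_finrank_span.2 hr.symm
    apply hli.ne_zero j
    ext i
    rcases i with i | i
    · fin_cases j <;> fin_cases i <;> simp_all [Matrix.col]
    · simpa [Matrix.col] using congrFun h0 i
  exact ⟨key l1 0 h1 rfl, key l2 1 h2 rfl⟩

theorem exists_input {m : ℕ} (C : Matrix (Fin m) (Fin 2) ℂ)
    (h1 : (fun i => C i 0) ≠ 0) (h2 : (fun i => C i 1) ≠ 0) :
    ∃ η : Fin m → ℂ, (Cᴴ *ᵥ η) 0 ≠ 0 ∧ (Cᴴ *ᵥ η) 1 ≠ 0 := by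
  have e : ∀ (η : Fin m → ℂ) (j : Fin 2), (Cᴴ *ᵥ η) j = star (fun i => C i j) ⬝ᵥ η := by
    intro η j
    simp [Matrix.mulVec, dotProduct]
  have n1 := (dotProduct_star_self_eq_zero (v := fun i => C i 0)).not.2 h1
  have n2 := (dotProduct_star_self_eq_zero (v := fun i => C i 1)).not.2 h2
  by_cases h : star (fun i => C i 1) ⬝ᵥ (fun i => C i 0) = 0
  · refine ⟨(fun i => C i 0) + (fun i => C i 1), ?_, ?_⟩
    · rw [e, dotProduct_add]
      have : star (fun i => C i 0) ⬝ᵥ (fun i => C i 1) = 0 := by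
        have := congrArg star h
        simpa [dotProduct, mul_comm] using this
      rw [this, add_zero]; exact n1
    · rw [e, dotProduct_add, h, zero_add]; exact n2
  · exact ⟨fun i => C i 0, by rw [e]; exact n1, by rw [e]; exact h⟩

theorem pow_ne_one_of_irr (φ : ℝ) (hirr : Irrational (φ / (2 * Real.pi))) (d : ℕ) (hd : 1 ≤ d) :
    (Complex.exp (φ * Complex.I)) ^ d ≠ 1 := by
  intro h
  rw [← Complex.exp_nat_mul, Complex.exp_eq_one_iff] at h
  obtain ⟨n, hn⟩ := h
  apply hirr
  refine ⟨(n : ℚ) / d, ?_⟩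
  have hd0 : (d : ℝ) ≠ 0 := by positivity
  have h1 : ((d : ℂ) * φ) * Complex.I = (n * (2 * Real.pi)) * Complex.I := by
    linear_combination hn
  have h2 := mul_right_cancel₀ Complex.I_ne_zero h1
  have h3 : (d : ℝ) * φ = n * (2 * Real.pi) := by exact_mod_cast h2
  have hpi := Real.pi_pos
  push_cast
  rw [div_eq_div_iff hd0 (by positivity)]
  linarith

theorem diagH_mulVec (l1 l2 x y : ℂ) :
    (Matrix.diagonal ![l1, l2])ᴴ *ᵥ ![x, y] = ![star l1 * x, star l2 * y] := by
  ext i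
  fin_cases i <;> simp [Matrix.diagonal_conjTranspose, Matrix.mulVec_diagonal]

/-- pathwise bound -/
theorem path_bound {m : ℕ} (l1 l2 : ℂ) (Lam : ℝ) (φ : ℝ)
    (hl1 : ‖l1‖ = Lam) (hl2 : ‖l2‖ = Lam) (hLam : 1 < Lam)
    (hphase : l2 = l1 * Complex.exp (φ * Complex.I))
    (C : Matrix (Fin m) (Fin 2) ℂ)
    (hdet : Detectable (Matrix.diagonal ![l1, l2]) C)
    (Q : Matrix (Fin 2) (Fin 2) ℂ) (R : Matrix (Fin m) (Fin m) ℂ)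
    (hQ : Q.PosDef) (hR : R.PosDef) (S0 : Matrix (Fin 2) (Fin 2) ℂ) (hS0 : S0.PosSemidef)
    (ε : ℝ) (hε : 0 < ε) :
    ∃ K : ℝ, 0 ≤ K ∧ ∀ g : ℕ → ℝ, (∀ k, g k = 0 ∨ g k = 1) → ∀ (k : ℕ) (x y : ℂ),
      (∀ a j, 1 ≤ a → a < j → j ≤ k → g (k - a) = 1 → g (k - j) = 1 →
        ε ≤ ‖star (Complex.exp (φ * Complex.I)) ^ (j - a) - 1‖ →
        qfm (ricc (Matrix.diagonal ![l1, l2]) C Q R S0 g k) ![x, y]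
          ≤ K * (‖x‖ ^ 2 + ‖y‖ ^ 2) * (Lam ^ 2) ^ j) ∧
      qfm (ricc (Matrix.diagonal ![l1, l2]) C Q R S0 g k) ![x, y]
          ≤ K * (‖x‖ ^ 2 + ‖y‖ ^ 2) * (Lam ^ 2) ^ k := by
  have hL : 1 < Lam ^ 2 := by nlinarith
  have ha1 : ‖star l1‖ ^ 2 = Lam ^ 2 := by rw [norm_star, hl1]
  have ha2 : ‖star l2‖ ^ 2 = Lam ^ 2 := by rw [norm_star, hl2]
  have haz : star l2 = star l1 * star (Complex.exp (φ * Complex.I)) := by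
    rw [hphase, star_mul, mul_comm]
  have hz : ‖star (Complex.exp (φ * Complex.I))‖ = 1 := by
    rw [norm_star, Complex.norm_exp_ofReal_mul_I]
  obtain ⟨hc1, hc2⟩ := col_ne_zero l1 l2 C (by rw [hl1]; exact hLam.le) (by rw [hl2]; exact hLam.le) hdet
  obtain ⟨η, hη1, hη2⟩ := exists_input C hc1 hc2
  obtain ⟨q, hq, hqb⟩ := qfm_bound Q
  obtain ⟨s0, hs0, hsb⟩ := qfm_bound S0
  have hr := qfm_nonneg hR.posSemidef η
  obtain ⟨K1, hK1, hpair⟩ := det_pair (star l1) (star l2) (star (Complex.exp (φ * Complex.I)))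
    ((Cᴴ *ᵥ η) 0) ((Cᴴ *ᵥ η) 1) (Lam ^ 2) hL ha1 ha2 haz hz hη1 hη2 q (qfm R η) ε hq hr hε
  have hL0 : 0 < Lam ^ 2 - 1 := by linarith
  set K2 := s0 + q / (Lam ^ 2 - 1) with hK2
  have hK2' : 0 ≤ K2 := by positivity
  refine ⟨K1 + K2, by positivity, fun g hg k x y => ?_⟩
  set V : ℕ → ℂ → ℂ → ℝ := fun k x y =>
    qfm (ricc (Matrix.diagonal ![l1, l2]) C Q R S0 g k) ![x, y] with hV
  have hpsd := ricc_psd (Matrix.diagonal ![l1, l2]) C Q R hQ hR S0 hS0 g hg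
  have h1 : ∀ k x y, V (k + 1) x y ≤ V k (star l1 * x) (star l2 * y)
      + q * (‖x‖ ^ 2 + ‖y‖ ^ 2) := by
    intro k x y
    have := qfm_step (Matrix.diagonal ![l1, l2]) C Q R hR _ (hpsd k) (g k) (hg k) ![x, y]
    rw [diagH_mulVec] at this
    exact this.trans (by have := hqb x y; simp only [hV]; linarith)
  have h2 : ∀ k, g k = 1 → ∀ x y s, V (k + 1) x y ≤
      V k (star l1 * x - s * (Cᴴ *ᵥ η) 0) (star l2 * y - s * (Cᴴ *ᵥ η) 1)
      + q * (‖x‖ ^ 2 + ‖y‖ ^ 2) + qfm R η * ‖s‖ ^ 2 := by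
    intro k hk x y s
    have := qfm_step_one (Matrix.diagonal ![l1, l2]) C Q R hR _ (hpsd k) ![x, y] (s • η)
    have e1 : (Matrix.diagonal ![l1, l2])ᴴ *ᵥ ![x, y] - Cᴴ *ᵥ (s • η)
        = ![star l1 * x - s * (Cᴴ *ᵥ η) 0, star l2 * y - s * (Cᴴ *ᵥ η) 1] := by
      rw [diagH_mulVec, Matrix.mulVec_smul]
      ext i
      fin_cases i <;> simp
    have e2 : qfm R (s • η) = qfm R η * ‖s‖ ^ 2 := by
      unfold qfm
      rw [Matrix.mulVec_smul, star_smul, smul_dotProduct, dotProduct_smul, smul_smul, smul_eq_mul]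
      have : star s * s = ((‖s‖ ^ 2 : ℝ) : ℂ) := by
        rw [mul_comm]; push_cast; exact Complex.mul_conj' s
      rw [this, Complex.re_ofReal_mul, mul_comm]
    rw [e1, e2] at this
    simp only [hV, ricc, hk]
    have := hqb x y
    linarith
  have h0 : ∀ k, V k 0 0 = 0 := by
    intro k
    have : (![0, 0] : Fin 2 → ℂ) = 0 := by ext i; fin_cases i <;> rfl
    simp [hV, this, qfm]
  have hn0 : 0 ≤ ‖x‖ ^ 2 + ‖y‖ ^ 2 := by positivity
  refine ⟨?_, ?_⟩
  · intro a j ha haj hjk hga hgj hgood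
    obtain ⟨a', rfl⟩ : ∃ a', a = a' + 1 := ⟨a - 1, by omega⟩
    obtain ⟨d, hd⟩ : ∃ d, j - (a' + 1) = d + 1 := ⟨j - (a' + 1) - 1, by omega⟩
    obtain ⟨t, ht⟩ : ∃ t, t = k - j := ⟨_, rfl⟩
    have hk : k = t + (d + 1) + (a' + 1) := by omega
    have hj : j = d + 1 + (a' + 1) := by omega
    have := hpair V g h1 h2 h0 t d a' (by rw [ht]; exact hgj)
      (by rw [← hga]; congr 1; omega) (by rw [← hd]; exact hgood) x y
    rw [← hk, ← hj] at this
    refine this.trans ?_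
    gcongr
    linarith
  · have h3 := det_iter (star l1) (star l2) (Lam ^ 2) hL ha1 ha2 q V h1 0 k x y
    rw [zero_add] at h3
    have h4 := hsb (star l1 ^ k * x) (star l2 ^ k * y)
    have n1 : ‖star l1 ^ k * x‖ ^ 2 = (Lam ^ 2) ^ k * ‖x‖ ^ 2 := by
      rw [norm_mul, norm_pow, mul_pow, ← pow_mul, mul_comm k 2, pow_mul, ha1]
    have n2 : ‖star l2 ^ k * y‖ ^ 2 = (Lam ^ 2) ^ k * ‖y‖ ^ 2 := by
      rw [norm_mul, norm_pow, mul_pow, ← pow_mul, mul_comm k 2, pow_mul, ha2]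
    rw [n1, n2] at h4
    have h5 : q * (((Lam ^ 2) ^ k - 1) / (Lam ^ 2 - 1)) * (‖x‖ ^ 2 + ‖y‖ ^ 2) ≤
        q / (Lam ^ 2 - 1) * (Lam ^ 2) ^ k * (‖x‖ ^ 2 + ‖y‖ ^ 2) := by
      have e : q * (((Lam ^ 2) ^ k - 1) / (Lam ^ 2 - 1))
          = q / (Lam ^ 2 - 1) * (Lam ^ 2) ^ k - q / (Lam ^ 2 - 1) := by ring
      have : 0 ≤ q / (Lam ^ 2 - 1) := by positivity
      apply mul_le_mul_of_nonneg_right _ hn0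
      linarith
    have h6 : 0 ≤ K1 * (‖x‖ ^ 2 + ‖y‖ ^ 2) * (Lam ^ 2) ^ k := by positivity
    have h7 : V 0 (star l1 ^ k * x) (star l2 ^ k * y)
        ≤ s0 * ((Lam ^ 2) ^ k * ‖x‖ ^ 2 + (Lam ^ 2) ^ k * ‖y‖ ^ 2) := h4
    change V k x y ≤ _
    rw [hK2]
    linarith

end Main

theorem upper_part {m : ℕ} (l1 l2 : ℂ) (Lam : ℝ) (φ : ℝ)
    (hl1 : ‖l1‖ = Lam) (hl2 : ‖l2‖ = Lam) (hLam : 1 < Lam)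
    (hphase : l2 = l1 * Complex.exp (φ * Complex.I))
    (hirr : Irrational (φ / (2 * Real.pi)))
    (C : Matrix (Fin m) (Fin 2) ℂ)
    (hdet : Detectable (Matrix.diagonal ![l1, l2]) C)
    (Q : Matrix (Fin 2) (Fin 2) ℂ) (R : Matrix (Fin m) (Fin m) ℂ)
    (hQ : Q.PosDef) (hR : R.PosDef)
    {Ω : Type} [MeasurableSpace Ω] (μ : Measure Ω) [IsProbabilityMeasure μ]
    (γ : ℕ → Ω → ℝ) (p : ℝ)
    (hmeas : ∀ k, Measurable (γ k))
    (hind : iIndepFun γ μ)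
    (h01 : ∀ k ω, γ k ω = 0 ∨ γ k ω = 1)
    (hber : ∀ k, μ {ω | γ k ω = 1} = ENNReal.ofReal p)
    (hp : 1 - (Lam ^ 2)⁻¹ < p) (S0 : Matrix (Fin 2) (Fin 2) ℂ) (hS0 : S0.PosSemidef) :
    EBounded μ (fun k ω =>
          ricc (Matrix.diagonal ![l1, l2]) C Q R S0 (fun i => γ i ω) k) := by
  have hL : 1 < Lam ^ 2 := by nlinarith
  have hq0 : 0 ≤ 1 - max p 0 := by
    have h := (prob_zero μ γ p hmeas hind h01 hber {0}).2
    rw [Finset.card_singleton, pow_one] at h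
    rw [← h]; exact measureReal_nonneg
  have hqL : (1 - max p 0) * Lam ^ 2 < 1 := by
    have h1 : 1 - max p 0 < (Lam ^ 2)⁻¹ := by
      have := le_max_left p 0
      linarith
    have := mul_lt_mul_of_pos_right h1 (show 0 < Lam ^ 2 by linarith)
    rwa [inv_mul_cancel₀ (by positivity)] at this
  obtain ⟨N, hN, B, hB0, hB⟩ := num_bound (Lam ^ 2) (1 - max p 0) hL hq0 hqL
  set z := star (Complex.exp (φ * Complex.I)) with hzdef
  have hz1 : ‖z‖ = 1 := by
    rw [hzdef, norm_star, Complex.norm_exp_ofReal_mul_I]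
  have hzne : ∀ d : ℕ, 1 ≤ d → z ^ d ≠ 1 := by
    intro d hd h
    apply pow_ne_one_of_irr φ hirr d hd
    have := congrArg star h
    rwa [hzdef, ← star_pow, star_star, star_one] at this
  obtain ⟨ε, hε, hgap⟩ := gap_eps z hzne N
  obtain ⟨K, hK, hpath⟩ := path_bound l1 l2 Lam φ hl1 hl2 hLam hphase C hdet Q R hQ hR S0 hS0 ε hε
  set S := Sset (fun d => ε ≤ ‖z ^ d - 1‖) with hSdef
  have hcard := card_Sset z hz1 N hN ε hgap
  have hint := ricc_integrable μ (Matrix.diagonal ![l1, l2]) C Q R S0 γ hmeas h01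
  have hmem : ∀ n a j, j ∈ S n a → 1 ≤ j ∧ j ≤ n ∧ j ≠ a ∧ (a < j → ε ≤ ‖z ^ (j - a) - 1‖) := by
    intro n a j hj
    simp only [hSdef, Sset, Finset.mem_filter, Finset.mem_Icc] at hj
    exact ⟨hj.1.1, hj.1.2, hj.2⟩
  -- expectation bound
  have hE : ∀ k x y, ∫ ω, qfm (ricc (Matrix.diagonal ![l1, l2]) C Q R S0 (fun i => γ i ω) k) ![x, y] ∂μ
      ≤ K * (‖x‖ ^ 2 + ‖y‖ ^ 2) * Lam ^ 2 * (1 + B) := by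
    intro k x y
    set F : ℕ → ℕ → Finset ℕ := fun n a => (S n a).image (fun j => k - j) with hF
    set E : ℕ → ℕ → Set Ω := fun n a => {ω | ∀ j ∈ F n a, γ j ω = 0} with hEd
    have hEm : ∀ n a, MeasurableSet (E n a) := fun n a =>
      (prob_zero μ γ p hmeas hind h01 hber (F n a)).1
    have hEp : ∀ n a, n < k → μ.real (E n a) = (1 - max p 0) ^ (S n a).card := by
      intro n a hnk
      rw [hEd, (prob_zero μ γ p hmeas hind h01 hber (F n a)).2, hF]
      congr 1
      apply Finset.card_image_of_injOn
      intro i hi j hj hij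
      have h1 := hmem n a i hi
      have h2 := hmem n a j hj
      simp only at hij
      omega
    have hii : ∀ n a, Integrable ((E n a).indicator (1 : Ω → ℝ)) μ := fun n a =>
      (integrable_const (1 : ℝ)).indicator (hEm n a)
    have hpt : ∀ ω, qfm (ricc (Matrix.diagonal ![l1, l2]) C Q R S0 (fun i => γ i ω) k) ![x, y] ≤
        K * (‖x‖ ^ 2 + ‖y‖ ^ 2) * Lam ^ 2 * (1 + ∑ n ∈ Finset.range k, (Lam ^ 2) ^ n *
          ∑ a ∈ Finset.Icc 1 n, (E n a).indicator (1 : Ω → ℝ) ω) := by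
      intro ω
      obtain ⟨hp1, hp2⟩ := hpath (fun i => γ i ω) (fun k => h01 k ω) k x y
      refine det_sum k (fun i => γ i ω) (fun k => h01 k ω) (Lam ^ 2)
        (K * (‖x‖ ^ 2 + ‖y‖ ^ 2)) _ hL (by positivity) (fun d => ε ≤ ‖z ^ d - 1‖) hp1 hp2 S hmem
        (fun n a => (E n a).indicator (1 : Ω → ℝ) ω) ?_ ?_
      · intro n a
        exact Set.indicator_nonneg (fun _ _ => zero_le_one) ω
      · intro n a h
        have : ω ∈ E n a := by
          intro j hj
          obtain ⟨i, hi, rfl⟩ := Finset.mem_image.1 hj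
          exact h i hi
        simp [this]
    have hs : ∀ n, Integrable (fun ω => (Lam ^ 2) ^ n *
          ∑ a ∈ Finset.Icc 1 n, (E n a).indicator (1 : Ω → ℝ) ω) μ := fun n =>
      (integrable_finsetSum _ fun a _ => hii n a).const_mul _
    have hs2 : Integrable (fun ω => ∑ n ∈ Finset.range k, (Lam ^ 2) ^ n *
          ∑ a ∈ Finset.Icc 1 n, (E n a).indicator (1 : Ω → ℝ) ω) μ :=
      integrable_finsetSum _ fun n _ => hs n
    have hs3 : Integrable (fun ω => 1 + ∑ n ∈ Finset.range k, (Lam ^ 2) ^ n *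
          ∑ a ∈ Finset.Icc 1 n, (E n a).indicator (1 : Ω → ℝ) ω) μ :=
      (integrable_const (1 : ℝ)).add hs2
    refine (integral_mono (qfm_matExp μ _ (hint k) _).1 (hs3.const_mul _) hpt).trans ?_
    rw [integral_const_mul]
    refine mul_le_mul_of_nonneg_left ?_ (by positivity)
    rw [integral_add (integrable_const (1 : ℝ)) hs2, integral_finsetSum _ fun n _ => hs n]
    have h1 : ∫ _ : Ω, (1 : ℝ) ∂μ = 1 := by simp
    rw [h1]
    refine add_le_add le_rfl ?_
    refine le_trans (le_of_eq ?_) (hB (fun n a => (S n a).card) hcard k)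
    refine Finset.sum_congr rfl fun n hn => ?_
    rw [integral_const_mul, integral_finsetSum _ fun a _ => hii n a]
    congr 1
    refine Finset.sum_congr rfl fun a _ => ?_
    rw [integral_indicator_one (hEm n a), hEp n a (Finset.mem_range.1 hn)]
  refine ⟨hint, ((K * Lam ^ 2 * (1 + B) : ℝ) : ℂ) • 1, ?_, fun k => ?_⟩
  · unfold Matrix.IsHermitian
    rw [Matrix.conjTranspose_smul, Matrix.conjTranspose_one]
    simp
  · unfold loe
    have hherm := matExp_herm μ (fun ω =>
      ricc (Matrix.diagonal ![l1, l2]) C Q R S0 (fun i => γ i ω) k) (fun ω =>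
      (ricc_psd _ C Q R hQ hR S0 hS0 _ (fun k => h01 k ω) k).isHermitian)
    have hherm2 : (((K * Lam ^ 2 * (1 + B) : ℝ) : ℂ) • (1 : Matrix (Fin 2) (Fin 2) ℂ) - matExp μ (fun ω =>
      ricc (Matrix.diagonal ![l1, l2]) C Q R S0 (fun i => γ i ω) k)).IsHermitian := by
      refine Matrix.IsHermitian.sub ?_ hherm
      unfold Matrix.IsHermitian
      rw [Matrix.conjTranspose_smul, Matrix.conjTranspose_one]
      simp
    refine Matrix.PosSemidef.of_dotProduct_mulVec_nonneg hherm2 fun v => ?_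
    rw [Complex.nonneg_iff]
    refine ⟨?_, (hherm2.im_star_dotProduct_mulVec_self v).symm⟩
    have hv : v = ![v 0, v 1] := by ext i; fin_cases i <;> rfl
    have h1 := hE k (v 0) (v 1)
    rw [← hv, ← (qfm_matExp μ _ (hint k) v).2] at h1
    rw [Matrix.sub_mulVec, dotProduct_sub, Complex.sub_re]
    have h2 : (star v ⬝ᵥ ((((K * Lam ^ 2 * (1 + B) : ℝ) : ℂ) • (1 : Matrix (Fin 2) (Fin 2) ℂ)) *ᵥ v)).re
        = K * Lam ^ 2 * (1 + B) * (‖v 0‖ ^ 2 + ‖v 1‖ ^ 2) := by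
      rw [Matrix.smul_mulVec, Matrix.one_mulVec, dotProduct_smul, smul_eq_mul,
        Complex.re_ofReal_mul]
      congr 1
      simp only [dotProduct, Fin.sum_univ_two, Pi.star_apply]
      have : ∀ s : ℂ, star s * s = ((‖s‖ ^ 2 : ℝ) : ℂ) := by
        intro s
        rw [mul_comm]; push_cast; exact Complex.mul_conj' s
      rw [this, this, ← Complex.ofReal_add, Complex.ofReal_re]
    rw [h2]
    unfold qfm at h1
    linarith

theorem lower_part {m : ℕ} (l1 l2 : ℂ) (Lam : ℝ)
    (hl1 : ‖l1‖ = Lam) (hLam : 1 < Lam)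
    (C : Matrix (Fin m) (Fin 2) ℂ)
    (Q : Matrix (Fin 2) (Fin 2) ℂ) (R : Matrix (Fin m) (Fin m) ℂ)
    (hQ : Q.PosDef) (hR : R.PosDef)
    {Ω : Type} [MeasurableSpace Ω] (μ : Measure Ω) [IsProbabilityMeasure μ]
    (γ : ℕ → Ω → ℝ) (p : ℝ)
    (hmeas : ∀ k, Measurable (γ k))
    (hind : iIndepFun γ μ)
    (h01 : ∀ k ω, γ k ω = 0 ∨ γ k ω = 1)
    (hber : ∀ k, μ {ω | γ k ω = 1} = ENNReal.ofReal p)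
    (hp : p < 1 - (Lam ^ 2)⁻¹) :
    ¬ EBounded μ (fun k ω =>
          ricc (Matrix.diagonal ![l1, l2]) C Q R 1 (fun i => γ i ω) k) := by
  rintro ⟨hint, M, hM, hle⟩
  have hL : 1 < Lam ^ 2 := by nlinarith
  have hqL : 1 < (1 - max p 0) * Lam ^ 2 := by
    have h1 : (Lam ^ 2)⁻¹ < 1 - max p 0 := by
      have : (Lam ^ 2)⁻¹ < 1 := inv_lt_one_of_one_lt₀ hL
      have : max p 0 < 1 - (Lam ^ 2)⁻¹ := max_lt hp (by linarith)
      linarith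
    have := mul_lt_mul_of_pos_right h1 (show 0 < Lam ^ 2 by linarith)
    rwa [inv_mul_cancel₀ (by positivity)] at this
  -- zero path
  have hzero : ∀ (k : ℕ) (g : ℕ → ℝ), (∀ j < k, g j = 0) → ∀ x : ℂ,
      (Lam ^ 2) ^ k * ‖x‖ ^ 2 ≤ qfm (ricc (Matrix.diagonal ![l1, l2]) C Q R 1 g k) ![x, 0] := by
    intro k g
    induction k with
    | zero =>
      intro _ x
      have : star x * x = ((‖x‖ ^ 2 : ℝ) : ℂ) := by
        rw [mul_comm]; push_cast; exact Complex.mul_conj' x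
      simp only [ricc, qfm, Matrix.one_mulVec, dotProduct, Fin.sum_univ_two, Pi.star_apply]
      simp only [Matrix.cons_val_zero, Matrix.cons_val_one, mul_zero, add_zero, this,
        Complex.ofReal_re, pow_zero, one_mul, le_refl]
    | succ k ih =>
      intro hg x
      rw [ricc, hg k (Nat.lt_succ_self k), riccStep_zero, qfm_add, qfm_conj, diagH_mulVec, mul_zero]
      have h1 := ih (fun j hj => hg j (hj.trans (Nat.lt_succ_self k))) (star l1 * x)
      rw [norm_mul, norm_star, hl1, mul_pow] at h1
      have h2 := qfm_nonneg hQ.posSemidef ![x, 0]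
      rw [pow_succ]
      linarith
  have hbound : ∀ k, ((1 - max p 0) * Lam ^ 2) ^ k ≤ qfm M ![1, 0] := by
    intro k
    have h1 := qfm_nonneg (hle k) ![1, 0]
    have h2 : qfm M ![1, 0] = qfm (matExp μ (fun ω =>
        ricc (Matrix.diagonal ![l1, l2]) C Q R 1 (fun i => γ i ω) k)) ![1, 0] +
        qfm (M - matExp μ (fun ω =>
        ricc (Matrix.diagonal ![l1, l2]) C Q R 1 (fun i => γ i ω) k)) ![1, 0] := by
      rw [← qfm_add]; congr 1; abel
    obtain ⟨h3, h4⟩ := qfm_matExp μ _ (hint k) ![1, 0]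
    obtain ⟨hm, hpr⟩ := prob_zero μ γ p hmeas hind h01 hber (Finset.range k)
    rw [Finset.card_range] at hpr
    have h5 : ∫ ω, (Lam ^ 2) ^ k *
        ({ω | ∀ j ∈ Finset.range k, γ j ω = 0}.indicator (1 : Ω → ℝ) ω) ∂μ ≤
        ∫ ω, qfm (ricc (Matrix.diagonal ![l1, l2]) C Q R 1 (fun i => γ i ω) k) ![1, 0] ∂μ := by
      refine integral_mono (((integrable_const (1 : ℝ)).indicator hm).const_mul _) h3 fun ω => ?_
      by_cases hω : ω ∈ {ω | ∀ j ∈ Finset.range k, γ j ω = 0}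
      · have := hzero k (fun i => γ i ω) (fun j hj => hω j (Finset.mem_range.2 hj)) 1
        simp only [Set.indicator_of_mem hω, Pi.one_apply, mul_one]
        simpa using this
      · simp only [Set.indicator_of_notMem hω, mul_zero]
        exact qfm_nonneg (ricc_psd _ C Q R hQ hR 1 Matrix.PosSemidef.one _ (fun k => h01 k ω) k) _
    rw [integral_const_mul, integral_indicator_one hm, hpr] at h5
    rw [mul_pow]
    linarith
  obtain ⟨k, hk⟩ := pow_unbounded_of_one_lt (qfm M ![1, 0]) hqL
  exact absurd (hbound k) (not_le.2 hk)

/-- second order degenerate system, irrational phase.  If `λ₂ = λ₁ e^{iφ}` with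
`|λ₁| = |λ₂| = Λ > 1`, `φ/(2π)` irrational, and `rank C = 1`, then the critical value is
`p_c = 1 − Λ⁻²`. -/
theorem stmt14 {m : ℕ} (l1 l2 : ℂ) (Lam : ℝ) (φ : ℝ)
    (hl1 : ‖l1‖ = Lam) (hl2 : ‖l2‖ = Lam) (hLam : 1 < Lam)
    (hphase : l2 = l1 * Complex.exp (φ * Complex.I))
    (hφ : φ ∈ Set.Ioo (0 : ℝ) (2 * Real.pi))
    (hirr : Irrational (φ / (2 * Real.pi)))
    (C : Matrix (Fin m) (Fin 2) ℂ) (hrank : C.rank = 1)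
    (hdet : Detectable (Matrix.diagonal ![l1, l2]) C)
    (Q : Matrix (Fin 2) (Fin 2) ℂ) (R : Matrix (Fin m) (Fin m) ℂ)
    (hQ : Q.PosDef) (hR : R.PosDef)
    {Ω : Type} [MeasurableSpace Ω] (μ : Measure Ω) [IsProbabilityMeasure μ]
    (γ : ℕ → Ω → ℝ) (p : ℝ)
    (hmeas : ∀ k, Measurable (γ k))
    (hind : iIndepFun γ μ)
    (h01 : ∀ k ω, γ k ω = 0 ∨ γ k ω = 1)
    (hber : ∀ k, μ {ω | γ k ω = 1} = ENNReal.ofReal p) :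
    (1 - (Lam ^ 2)⁻¹ < p →
      ∀ S0 : Matrix (Fin 2) (Fin 2) ℂ, S0.PosSemidef →
        EBounded μ (fun k ω =>
          ricc (Matrix.diagonal ![l1, l2]) C Q R S0 (fun i => γ i ω) k)) ∧
    (p < 1 - (Lam ^ 2)⁻¹ →
      ∃ S0 : Matrix (Fin 2) (Fin 2) ℂ, S0.PosSemidef ∧
        ¬ EBounded μ (fun k ω =>
          ricc (Matrix.diagonal ![l1, l2]) C Q R S0 (fun i => γ i ω) k)) := by
  exact ⟨fun hp S0 hS0 => upper_part l1 l2 Lam φ hl1 hl2 hLam hphase hirr C hdet Q R hQ hR μ γ p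
      hmeas hind h01 hber hp S0 hS0,
    fun hp => ⟨1, Matrix.PosSemidef.one, lower_part l1 l2 Lam hl1 hLam C Q R hQ hR μ γ p
      hmeas hind h01 hber hp⟩⟩
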